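/- arXiv:2508.19064 — 2 statements merged into one kernel-verified Lean document; each statement's English description precedes it below -/
import Mathlib

section
/- Let h : ℝ²×ℝ → ℂ be a Schwartz function with h(x₁₂,x₃) = 0 whenever x₃ < 0, and let q(t,ξ) = (t/(4π)) ∫_{S²} h((ξ,0)+tη) dS(η) be its planar photoacoustic data. Then for every σ ∈ ℝ² and every ϱ ∈ ℝ with ϱ ≠ 0, writing ω = sgn(ϱ)·√(ϱ² + ‖σ‖²), one has 𝓕h(σ,ϱ) = −2iϱ · lim_{ε→0⁺} (2π)^{−3/2} ∫₀^∞ e^{(iω−ε)t} ( ∫_{ℝ²} q(t,ξ) e^{i σ·ξ} dξ ) dt; in particular the inner integral is absolutely convergent for each t, the outer integral is absolutely convergent for each ε > 0, and the limit as ε → 0⁺ exists. -/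
open MeasureTheory Real Complex Filter
open scoped RealInnerProductSpace

/-- Embedding of `ℝ² × ℝ` into `ℝ³` (Euclidean). -/
noncomputable def emb (ξ : EuclideanSpace ℝ (Fin 2)) (r : ℝ) : EuclideanSpace ℝ (Fin 3) :=
  (EuclideanSpace.equiv (Fin 3) ℝ).symm ![ξ 0, ξ 1, r]

/-- Planar photoacoustic data `Q(t,ξ) = (t/(4π)) ∫_{S²} h((ξ,0)+tη) dS(η)`,
where `dS` is the surface measure on the unit sphere of `ℝ³`. -/
noncomputable def Q (h : EuclideanSpace ℝ (Fin 3) → ℂ) (t : ℝ)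
    (ξ : EuclideanSpace ℝ (Fin 2)) : ℂ :=
  ((t / (4 * π) : ℝ) : ℂ) * ∫ η : Metric.sphere (0 : EuclideanSpace ℝ (Fin 3)) 1,
    h (emb ξ 0 + t • (η : EuclideanSpace ℝ (Fin 3)))
    ∂((volume : Measure (EuclideanSpace ℝ (Fin 3))).toSphere)


lemma aux_ftc (g g' : ℝ → ℝ) (m l : ℝ) (h0 : Tendsto g (nhdsWithin 0 (Set.Ioi 0)) (nhds m))
    (hl : Tendsto g atTop (nhds l)) (hd : ∀ x, 0 < x → HasDerivAt g (g' x) x)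
    (hn : ∀ x, 0 < x → 0 ≤ g' x) :
    IntegrableOn g' (Set.Ioi 0) ∧ ∫ x in Set.Ioi 0, g' x = l - m := by
  have hc : ContinuousWithinAt (Function.update g 0 m) (Set.Ici 0) 0 := by
    rw [continuousWithinAt_update_same]
    simpa using h0
  have hd' : ∀ x ∈ Set.Ioi (0:ℝ), HasDerivAt (Function.update g 0 m) (g' x) x := by
    intro x hx
    refine (hd x hx).congr_of_eventuallyEq ?_
    filter_upwards [lt_mem_nhds (Set.mem_Ioi.1 hx)] with y hy
    simp [Function.update_of_ne hy.ne']
  have hl' : Tendsto (Function.update g 0 m) atTop (nhds l) := by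
    refine hl.congr' ?_
    filter_upwards [eventually_gt_atTop 0] with y hy
    simp [Function.update_of_ne (ne_of_gt hy)]
  refine ⟨integrableOn_Ioi_deriv_of_nonneg hc hd' (fun x hx => hn x hx) hl', ?_⟩
  rw [integral_Ioi_of_hasDerivAt_of_nonneg hc hd' (fun x hx => hn x hx) hl']
  simp

noncomputable def Gerf (x : ℝ) : ℝ := ∫ t in (0:ℝ)..x, Real.exp (-t ^ 2)

lemma Gerf_deriv (x : ℝ) : HasDerivAt Gerf (Real.exp (-x ^ 2)) x := by
  have hc : Continuous (fun t : ℝ => Real.exp (-t ^ 2)) := by fun_prop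
  exact intervalIntegral.integral_hasDerivAt_right (hc.intervalIntegrable _ _)
    (hc.stronglyMeasurableAtFilter _ _) hc.continuousAt

lemma Gerf_top : Tendsto Gerf atTop (nhds (√π / 2)) := by
  have h1 : ∫ t in Set.Ioi (0:ℝ), Real.exp (-t ^ 2) = √π / 2 := by
    simpa using integral_gaussian_Ioi 1
  rw [← h1]
  refine intervalIntegral_tendsto_integral_Ioi 0 ?_ tendsto_id
  have := (integrable_exp_neg_mul_sq (b := 1) one_pos).integrableOn (s := Set.Ioi 0)
  simpa using this

lemma Gerf_neg (x : ℝ) : Gerf (-x) = - Gerf x := by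
  unfold Gerf
  have := intervalIntegral.integral_comp_neg (a := 0) (b := x) (fun t : ℝ => Real.exp (-t ^ 2))
  simp only [neg_sq, neg_zero] at this
  rw [this, intervalIntegral.integral_symm]

lemma Gerf_bot : Tendsto Gerf atBot (nhds (-(√π / 2))) := by
  have := (Gerf_top.comp tendsto_neg_atBot_atTop).neg
  refine this.congr fun x => ?_
  simp [Gerf_neg]

lemma Gp_zero (k b : ℝ) (hb : 0 < b) :
    Tendsto (fun u => Gerf (k * u + b / u)) (nhdsWithin 0 (Set.Ioi 0)) (nhds (√π / 2)) := by
  refine Gerf_top.comp ?_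
  have h1 : Tendsto (fun u : ℝ => k * u) (nhdsWithin 0 (Set.Ioi 0)) (nhds (k * 0)) :=
    ((continuous_const.mul continuous_id).tendsto 0).mono_left nhdsWithin_le_nhds
  have h2 : Tendsto (fun u : ℝ => b / u) (nhdsWithin 0 (Set.Ioi 0)) atTop :=
    tendsto_inv_nhdsGT_zero.const_mul_atTop hb
  exact h1.add_atTop h2

lemma Gm_zero (k b : ℝ) (hb : 0 < b) :
    Tendsto (fun u => Gerf (k * u - b / u)) (nhdsWithin 0 (Set.Ioi 0)) (nhds (-(√π / 2))) := by
  have := (Gp_zero (-k) b hb).neg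
  refine this.congr fun x => ?_
  rw [← Gerf_neg]; congr 1; ring

lemma Gp_top (k b : ℝ) (hk : 0 < k) :
    Tendsto (fun u => Gerf (k * u + b / u)) atTop (nhds (√π / 2)) := by
  refine Gerf_top.comp ?_
  have h1 : Tendsto (fun u : ℝ => k * u) atTop atTop := tendsto_id.const_mul_atTop hk
  have h2 : Tendsto (fun u : ℝ => b / u) atTop (nhds 0) := tendsto_id.const_div_atTop b
  exact h1.atTop_add h2

lemma Gp_deriv (k b u : ℝ) (hu : 0 < u) :
    HasDerivAt (fun u => Gerf (k * u + b / u)) (Real.exp (-(k*u+b/u)^2) * (k - b / u^2)) u := by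
  have h1 : HasDerivAt (fun u : ℝ => k * u + b / u) (k - b / u^2) u := by
    have := ((hasDerivAt_id u).const_mul k).add ((hasDerivAt_inv hu.ne').const_mul b)
    refine this.congr_deriv ?_
    field_simp
    ring
  exact (Gerf_deriv _).comp u h1

lemma glasser1 (k b : ℝ) (hk : 0 < k) (hb : 0 < b) :
    IntegrableOn (fun u : ℝ => Real.exp (-(k^2*u^2) - b^2/u^2)) (Set.Ioi 0) ∧
    ∫ u in Set.Ioi (0:ℝ), Real.exp (-(k^2*u^2) - b^2/u^2) = √π * Real.exp (-(2*k*b)) / (2*k) := by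
  have key := aux_ftc (fun u => (2*k)⁻¹ * (Real.exp (-(2*k*b)) * Gerf (k*u + (-b)/u) +
    Real.exp (2*k*b) * Gerf (k*u+b/u))) (fun u : ℝ => Real.exp (-(k^2*u^2) - b^2/u^2)) _ _
    (((((Gm_zero k b hb).congr (fun u => by rw [neg_div, sub_eq_add_neg])).const_mul _).add
      ((Gp_zero k b hb).const_mul _)).const_mul _)
    ((((Gp_top k (-b) hk).const_mul _).add
      ((Gp_top k b hk).const_mul _)).const_mul _) ?_ (fun x _ => (Real.exp_pos _).le)
  · refine ⟨key.1, key.2.trans ?_⟩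
    field_simp
    ring
  · intro u hu
    have := (((Gp_deriv k (-b) u hu).const_mul (Real.exp (-(2*k*b)))).add
      ((Gp_deriv k b u hu).const_mul (Real.exp (2*k*b)))).const_mul (2*k)⁻¹
    refine this.congr_deriv ?_
    rw [← mul_assoc, ← mul_assoc, ← Real.exp_add, ← Real.exp_add]
    have e1 : -(2*k*b) + -(k*u + (-b)/u)^2 = -(k^2*u^2) - b^2/u^2 := by field_simp; ring
    have e2 : (2*k*b) + -(k*u + b/u)^2 = -(k^2*u^2) - b^2/u^2 := by field_simp; ring
    rw [e1, e2]
    field_simp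
    ring

lemma glasser2 (k b : ℝ) (hk : 0 < k) (hb : 0 < b) :
    ∫ u in Set.Ioi (0:ℝ), Real.exp (-(k^2*u^2) - b^2/u^2) / u^2 = √π * Real.exp (-(2*k*b)) / (2*b) := by
  have key := aux_ftc (fun u => (2*b)⁻¹ * (Real.exp (-(2*k*b)) * Gerf (k*u + (-b)/u) -
    Real.exp (2*k*b) * Gerf (k*u+b/u))) (fun u : ℝ => Real.exp (-(k^2*u^2) - b^2/u^2) / u^2) _ _
    (((((Gm_zero k b hb).congr (fun u => by rw [neg_div, sub_eq_add_neg])).const_mul _).sub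
      ((Gp_zero k b hb).const_mul _)).const_mul _)
    ((((Gp_top k (-b) hk).const_mul _).sub
      ((Gp_top k b hk).const_mul _)).const_mul _) ?_ (fun x _ => by positivity)
  · refine key.2.trans ?_
    field_simp
    ring
  · intro u hu
    have := (((Gp_deriv k (-b) u hu).const_mul (Real.exp (-(2*k*b)))).sub
      ((Gp_deriv k b u hu).const_mul (Real.exp (2*k*b)))).const_mul (2*b)⁻¹
    refine this.congr_deriv ?_
    rw [← mul_assoc, ← mul_assoc, ← Real.exp_add, ← Real.exp_add]
    have e1 : -(2*k*b) + -(k*u + (-b)/u)^2 = -(k^2*u^2) - b^2/u^2 := by field_simp; ring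
    have e2 : (2*k*b) + -(k*u + b/u)^2 = -(k^2*u^2) - b^2/u^2 := by field_simp; ring
    rw [e1, e2]
    field_simp
    ring

abbrev E2 := EuclideanSpace ℝ (Fin 2)
abbrev E3 := EuclideanSpace ℝ (Fin 3)

lemma int_exp_norm2 (c : ℝ) (hc : 0 < c) : Integrable (fun y : E2 => Real.exp (-(c * ‖y‖))) := by
  have h := (integrable_fun_norm_addHaar (volume : Measure E2)
    (f := fun t : ℝ => Real.exp (-(c*t)))).2
  refine h ?_
  have := integrableOn_rpow_mul_exp_neg_mul_rpow (p := 1) (s := 1) (b := c) (by norm_num) one_pos hc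
  simpa using this

lemma int_exp_norm3 (c : ℝ) (hc : 0 < c) :
    Integrable (fun y : E3 => Real.exp (-(c * ‖y‖)) / ‖y‖) := by
  have h := (integrable_fun_norm_addHaar (volume : Measure E3)
    (f := fun t : ℝ => Real.exp (-(c*t)) / t)).2
  refine h ?_
  have := integrableOn_rpow_mul_exp_neg_mul_rpow (p := 1) (s := 1) (b := c) (by norm_num) one_pos hc
  refine this.congr_fun ?_ measurableSet_Ioi
  intro t ht
  have : t ≠ 0 := (Set.mem_Ioi.1 ht).ne'
  simp
  field_simp

noncomputable def rr (z : ℝ) (y : E2) : ℝ := √(‖y‖^2 + z^2)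

lemma rr_cont (z : ℝ) : Continuous (rr z) := by unfold rr; fun_prop
lemma rr_pos (z : ℝ) (hz : 0 < z) (y : E2) : 0 < rr z y := by unfold rr; positivity
lemma rr_sq (z : ℝ) (y : E2) : rr z y ^ 2 = ‖y‖^2 + z^2 := Real.sq_sqrt (by positivity)
lemma rr_ge (z : ℝ) (y : E2) : ‖y‖ ≤ rr z y := Real.le_sqrt_of_sq_le (by nlinarith [sq_nonneg z])
lemma rr_ge' (z : ℝ) (y : E2) : z ≤ rr z y := Real.le_sqrt_of_sq_le (by nlinarith [sq_nonneg ‖y‖])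

lemma int_exp_rr (z c : ℝ) (hc : 0 < c) : Integrable (fun y : E2 => Real.exp (-(c * rr z y))) := by
  refine (int_exp_norm2 c hc).mono' ?_ (ae_of_all _ fun y => ?_)
  · have := rr_cont z
    exact Continuous.aestronglyMeasurable (by fun_prop)
  · rw [Real.norm_of_nonneg (Real.exp_pos _).le]
    gcongr
    exact rr_ge z y

noncomputable def Ker (σ : E2) (z : ℝ) (p : ℂ) (y : E2) : ℂ :=
  cexp (-(p * rr z y)) / rr z y * cexp (-I * ((⟪σ, y⟫ : ℝ) : ℂ))

lemma norm_ph (t : ℝ) : ‖cexp (-I * (t : ℂ))‖ = 1 := by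
  rw [neg_mul, mul_comm, ← neg_mul, ← Complex.ofReal_neg]; exact Complex.norm_exp_ofReal_mul_I _

lemma norm_ph' (t : ℝ) : ‖cexp (I * (t : ℂ))‖ = 1 := by
  rw [mul_comm]; exact Complex.norm_exp_ofReal_mul_I _

lemma Ker_cont (σ : E2) (z : ℝ) (hz : 0 < z) (p : ℂ) : Continuous (Ker σ z p) := by
  unfold Ker
  have := rr_cont z
  have h2 : ∀ y, ((rr z y : ℝ) : ℂ) ≠ 0 := fun y => by exact_mod_cast (rr_pos z hz y).ne'
  fun_prop (disch := assumption)

lemma Ker_norm (σ : E2) (z : ℝ) (p : ℂ) (y : E2) :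
    ‖Ker σ z p y‖ = Real.exp (-(p.re * rr z y)) / rr z y := by
  have hn : 0 ≤ rr z y := Real.sqrt_nonneg _
  unfold Ker
  rw [norm_mul, norm_ph, norm_div, Complex.norm_exp, Complex.norm_real,
    Real.norm_of_nonneg hn]
  simp

lemma Ker_int (σ : E2) (z : ℝ) (hz : 0 < z) (p : ℂ) (hp : 0 < p.re) : Integrable (Ker σ z p) := by
  refine ((int_exp_rr z p.re hp).div_const z).mono' (Ker_cont σ z hz p).aestronglyMeasurable
    (ae_of_all _ fun y => ?_)
  rw [Ker_norm]
  gcongr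
  exact rr_ge' z y

lemma yuk_real (σ : E2) (z p k : ℝ) (hz : 0 < z) (hp : 0 < p) (hk : 0 < k)
    (hkp : k^2 = p^2 + ‖σ‖^2) :
    ∫ y, Ker σ z p y = 2 * π * cexp (-(k * z)) / k := by
  let f : E2 → ℝ → ℂ := fun y u =>
    cexp (-I * ((⟪σ, y⟫ : ℝ) : ℂ)) * ((Real.exp (-((rr z y)^2*u^2) - (p/2)^2/u^2) : ℝ) : ℂ)
  have hfn : ∀ y u, ‖f y u‖ = Real.exp (-((rr z y)^2*u^2) - (p/2)^2/u^2) := by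
    intro y u
    simp only [f]
    rw [norm_mul, norm_ph, Complex.norm_real, Real.norm_of_nonneg (Real.exp_pos _).le, one_mul]
  have hFub : Integrable (Function.uncurry f) (volume.prod (volume.restrict (Set.Ioi (0:ℝ)))) := by
    rw [integrable_prod_iff]
    · refine ⟨ae_of_all _ fun y => ?_, ?_⟩
      · have := (glasser1 (rr z y) (p/2) (rr_pos z hz y) (by positivity)).1
        exact (Integrable.ofReal (𝕜 := ℂ) this).const_mul (cexp (-I * ((⟪σ, y⟫ : ℝ) : ℂ)))
      · simp only [Function.uncurry_apply_pair, hfn]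
        have : ∀ y, ∫ u in Set.Ioi (0:ℝ), Real.exp (-((rr z y)^2*u^2) - (p/2)^2/u^2) =
            √π / 2 * ‖Ker σ z p y‖ := by
          intro y
          rw [(glasser1 (rr z y) (p/2) (rr_pos z hz y) (by positivity)).2, Ker_norm]
          have := rr_pos z hz y
          simp only [Complex.ofReal_re]
          field_simp
        simp only [this]
        exact (Ker_int σ z hz p (by simpa using hp)).norm.const_mul _
    · have := (rr_cont z).measurable
      refine Measurable.aestronglyMeasurable ?_
      simp only [f, Function.uncurry_def]
      fun_prop
  have hsw := integral_integral_swap hFub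
  have hL : ∀ y, ∫ u in Set.Ioi (0:ℝ), f y u = (√π / 2 : ℝ) * Ker σ z p y := by
    intro y
    simp only [f]
    rw [integral_const_mul, integral_complex_ofReal,
      (glasser1 (rr z y) (p/2) (rr_pos z hz y) (by positivity)).2]
    unfold Ker
    have : ((rr z y : ℝ) : ℂ) ≠ 0 := by exact_mod_cast (rr_pos z hz y).ne'
    push_cast
    field_simp
  have hR : ∀ u ∈ Set.Ioi (0:ℝ), ∫ y, f y u =
      ((π * (Real.exp (-(z^2*u^2) - (k/2)^2/u^2) / u^2) : ℝ) : ℂ) := by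
    intro u hu
    have hu : 0 < u := hu
    have huc : (u : ℂ) ≠ 0 := by exact_mod_cast hu.ne'
    have h1 : ∀ y, f y u = ((Real.exp (-(z^2*u^2) - (p/2)^2/u^2) : ℝ) : ℂ) *
        cexp (-(u^2 : ℂ) * ‖y‖^2 + (-I) * (⟪σ, y⟫ : ℝ)) := by
      intro y
      simp only [f, rr_sq, Complex.ofReal_exp]
      rw [← Complex.exp_add, ← Complex.exp_add]
      congr 1
      push_cast
      ring
    simp only [h1]
    rw [integral_const_mul, GaussianFourier.integral_cexp_neg_mul_sq_norm_add (by
      rw [← Complex.ofReal_pow, Complex.ofReal_re]; positivity)]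
    have h2 : ((Module.finrank ℝ E2 : ℂ) / 2) = 1 := by simp
    rw [h2, Complex.cpow_one, neg_sq, I_sq, Complex.ofReal_exp]
    push_cast
    rw [mul_left_comm, ← Complex.exp_add]
    have h3 : (-((z:ℂ) ^ 2 * u ^ 2) - (p / 2) ^ 2 / u ^ 2 + -1 * ‖σ‖ ^ 2 / (4 * u ^ 2))
      = -((z:ℂ) ^ 2 * u ^ 2) - (k / 2) ^ 2 / u ^ 2 := by
      have : (k:ℂ)^2 = p^2 + ‖σ‖^2 := by exact_mod_cast hkp
      field_simp
      rw [this]; ring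
    rw [h3]; field_simp
  simp only [hL] at hsw
  rw [setIntegral_congr_fun measurableSet_Ioi hR, integral_const_mul, integral_complex_ofReal,
    integral_const_mul, glasser2 z (k/2) hz (by positivity)] at hsw
  have hpi : ((√π : ℝ) : ℂ) ≠ 0 := by
    exact_mod_cast (Real.sqrt_pos.2 Real.pi_pos).ne'
  have hkc : (k : ℂ) ≠ 0 := by exact_mod_cast hk.ne'
  have h4 : ((√π / 2 : ℝ) : ℂ) ≠ 0 := by
    exact_mod_cast (half_pos (Real.sqrt_pos.2 Real.pi_pos)).ne'
  refine mul_left_cancel₀ h4 (hsw.trans ?_)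
  push_cast
  rw [show (2 * (z:ℂ) * (k/2)) = k * z by ring]
  field_simp

lemma Ker_diff (σ : E2) (z : ℝ) (hz : 0 < z) :
    DifferentiableOn ℂ (fun p => ∫ y, Ker σ z p y) {p | 0 < p.re} := by
  intro p hp
  have hp : 0 < p.re := hp
  refine DifferentiableAt.differentiableWithinAt ?_
  have hs : {q : ℂ | p.re / 2 < q.re} ∈ nhds p :=
    (isOpen_lt continuous_const Complex.continuous_re).mem_nhds (by simp; linarith)
  have := hasDerivAt_integral_of_dominated_loc_of_deriv_le (μ := (volume : Measure E2))
    (F := fun p y => Ker σ z p y)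
    (F' := fun p y => - cexp (-(p * rr z y)) * cexp (-I * ((⟪σ, y⟫ : ℝ) : ℂ)))
    (bound := fun y => Real.exp (-(p.re / 2 * rr z y))) hs
    (Eventually.of_forall fun q => (Ker_cont σ z hz q).aestronglyMeasurable)
    (Ker_int σ z hz p hp) ?_ ?_ (int_exp_rr z _ (by linarith)) ?_
  · exact this.2.differentiableAt
  · have := rr_cont z
    exact Continuous.aestronglyMeasurable (by fun_prop)
  · refine ae_of_all _ fun y q hq => ?_
    rw [norm_mul, norm_ph, norm_neg, Complex.norm_exp]
    simp only [Complex.neg_re, Complex.re_mul_ofReal, mul_one]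
    have hq : p.re / 2 < q.re := hq
    have := rr_pos z hz y
    gcongr
  · refine ae_of_all _ fun y q hq => ?_
    have h0 : ((rr z y : ℝ) : ℂ) ≠ 0 := by exact_mod_cast (rr_pos z hz y).ne'
    have h1 : HasDerivAt (fun q : ℂ => -(q * rr z y)) (-(rr z y)) q := by
      have h2 := ((hasDerivAt_id q).mul_const ((rr z y : ℝ) : ℂ)).neg
      rw [one_mul] at h2
      exact h2
    have := (h1.cexp.div_const ((rr z y : ℝ) : ℂ)).mul_const (cexp (-I * ((⟪σ, y⟫ : ℝ) : ℂ)))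
    refine this.congr_deriv ?_
    field_simp

lemma slit (σ : E2) (p : ℂ) (hp : 0 < p.re) : p^2 + (‖σ‖:ℂ)^2 ∈ slitPlane := by
  rw [Complex.mem_slitPlane_iff]
  by_cases h : p.im = 0
  · left
    simp [pow_two, h]
    nlinarith [mul_pos hp hp, mul_self_nonneg ‖σ‖]
  · right
    simp [pow_two]
    intro h'
    have : p.re * p.im = 0 := by linarith
    rcases mul_eq_zero.1 this with h1 | h1
    · exact hp.ne' h1
    · exact h h1

noncomputable def kk (σ : E2) (p : ℂ) : ℂ := (p^2 + (‖σ‖:ℂ)^2) ^ (1/2 : ℂ)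

lemma kk_sq (σ : E2) (p : ℂ) : kk σ p ^ 2 = p^2 + (‖σ‖:ℂ)^2 := by
  unfold kk
  rw [← Complex.cpow_nat_mul]; simp

lemma kk_ne (σ : E2) (p : ℂ) (hp : 0 < p.re) : kk σ p ≠ 0 := by
  intro h
  have := kk_sq σ p
  rw [h] at this
  exact Complex.slitPlane_ne_zero (slit σ p hp) (by rw [← this]; simp)

lemma kk_re (σ : E2) (p : ℂ) (hp : 0 < p.re) : 0 < (kk σ p).re := by
  have h0 := Complex.slitPlane_ne_zero (slit σ p hp)
  unfold kk
  rw [Complex.cpow_def_of_ne_zero h0, Complex.exp_re]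
  refine mul_pos (Real.exp_pos _) (Real.cos_pos_of_mem_Ioo ?_)
  have h1 : (Complex.log (p^2 + (‖σ‖:ℂ)^2) * (1/2)).im = (p^2 + (‖σ‖:ℂ)^2).arg / 2 := by
    rw [show (1/2 : ℂ) = ((1/2 : ℝ) : ℂ) by push_cast; rfl, Complex.im_mul_ofReal, Complex.log_im]
    ring
  rw [h1]
  have h2 := Complex.neg_pi_lt_arg (p^2 + (‖σ‖:ℂ)^2)
  have h3 := lt_of_le_of_ne (Complex.arg_le_pi _) (Complex.slitPlane_arg_ne_pi (slit σ p hp))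
  constructor <;> linarith

lemma yuk (σ : E2) (z : ℝ) (hz : 0 < z) (p : ℂ) (hp : 0 < p.re) :
    ∫ y, Ker σ z p y = 2 * π * cexp (-(kk σ p * z)) / kk σ p := by
  have ho : IsOpen {p : ℂ | 0 < p.re} := isOpen_lt continuous_const Complex.continuous_re
  have hA := (Ker_diff σ z hz).analyticOnNhd ho
  have hkd : DifferentiableOn ℂ (kk σ) {p : ℂ | 0 < p.re} := by
    intro q hq
    refine DifferentiableAt.differentiableWithinAt ?_
    unfold kk
    refine DifferentiableAt.cpow (by fun_prop) (by fun_prop) (slit σ q hq)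
  have hB : DifferentiableOn ℂ (fun p => 2 * π * cexp (-(kk σ p * z)) / kk σ p)
      {p : ℂ | 0 < p.re} := by
    refine DifferentiableOn.div ?_ hkd (fun q hq => kk_ne σ q hq)
    fun_prop
  have hB := hB.analyticOnNhd ho
  have hpc : IsPreconnected {p : ℂ | 0 < p.re} := (convex_halfSpace_re_gt 0).isPreconnected
  refine hA.eqOn_of_preconnected_of_frequently_eq hB hpc (z₀ := 1) (by simp) ?_ hp
  have hreal : ∀ x : ℝ, 0 < x → (∫ y, Ker σ z (x:ℂ) y) =
      2 * π * cexp (-(kk σ x * z)) / kk σ x := by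
    intro x hx
    have e : kk σ x = ((√(x^2 + ‖σ‖^2) : ℝ) : ℂ) := by
      unfold kk
      rw [Real.sqrt_eq_rpow, Complex.ofReal_cpow (by positivity)]
      push_cast; rfl
    rw [e]
    exact yuk_real σ z x _ hz hx (by positivity) (Real.sq_sqrt (by positivity))
  have hfreq : ∃ᶠ (x : ℝ) in nhdsWithin 1 {1}ᶜ, (∫ y, Ker σ z (x:ℂ) y) =
      2 * π * cexp (-(kk σ x * z)) / kk σ x := by
    refine Eventually.frequently ?_
    filter_upwards [nhdsWithin_le_nhds (lt_mem_nhds (one_pos : (0:ℝ) < 1))] with x hx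
    exact hreal x hx
  have ht : Tendsto (fun x : ℝ => (x : ℂ)) (nhdsWithin 1 {1}ᶜ) (nhdsWithin 1 {1}ᶜ) := by
    refine tendsto_nhdsWithin_iff.2 ⟨?_, ?_⟩
    · have := (Complex.continuous_ofReal.tendsto 1)
      rw [Complex.ofReal_one] at this
      exact this.mono_left nhdsWithin_le_nhds
    · filter_upwards [self_mem_nhdsWithin] with x hx
      simpa using hx
  exact ht.frequently hfreq

noncomputable def embE : (E2 × ℝ) ≃ᵐ E3 :=
  (((MeasurableEquiv.toLp 2 (Fin 2 → ℝ)).symm.prodCongr (MeasurableEquiv.refl ℝ)).trans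
    MeasurableEquiv.prodComm).trans
    ((MeasurableEquiv.piFinSuccAbove (fun _ : Fin 3 => ℝ) (Fin.last 2)).symm.trans
      (MeasurableEquiv.toLp 2 (Fin 3 → ℝ)))

lemma embE_apply (w : E2 × ℝ) : embE w = emb w.1 w.2 := by
  ext i
  simp only [embE, emb]
  fin_cases i <;>
  simp [MeasurableEquiv.trans_apply, MeasurableEquiv.prodCongr, MeasurableEquiv.prodComm,
    MeasurableEquiv.piFinSuccAbove, Fin.insertNthEquiv, Fin.insertNth] <;> rfl

lemma embE_mp : MeasurePreserving embE (volume.prod volume) volume := by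
  unfold embE
  refine MeasurePreserving.trans (μb := (volume : Measure ℝ).prod (volume : Measure (Fin 2 → ℝ)))
    ?_ (MeasurePreserving.trans (μb := (volume : Measure (Fin 3 → ℝ))) ?_ ?_)
  · refine MeasurePreserving.trans
      (μb := (volume : Measure (Fin 2 → ℝ)).prod (volume : Measure ℝ)) ?_ ?_
    · exact (EuclideanSpace.volume_preserving_symm_measurableEquiv_toLp (Fin 2)).prod
        (MeasurePreserving.id _)
    · exact Measure.measurePreserving_swap
  · exact (volume_preserving_piFinSuccAbove (fun _ : Fin 3 => ℝ) (Fin.last 2)).symm _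
  · exact (EuclideanSpace.volume_preserving_symm_measurableEquiv_toLp (Fin 3)).symm _

lemma emb_int (f : E3 → ℂ) (hf : Integrable f) :
    Integrable (fun w : E2 × ℝ => f (emb w.1 w.2)) (volume.prod volume) := by
  have := (embE_mp.integrable_comp_emb embE.measurableEmbedding (g := f)).2 hf
  simpa only [Function.comp_def, embE_apply] using this

lemma emb_integral (f : E3 → ℂ) (hf : Integrable f) :
    ∫ x, f x = ∫ z : ℝ, ∫ y : E2, f (emb y z) := by
  rw [← embE_mp.integral_comp embE.measurableEmbedding f]
  simp only [embE_apply]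
  exact integral_prod_symm _ (emb_int f hf)

@[simp] lemma emb_0 (y : E2) (z : ℝ) : emb y z 0 = y 0 := by simp [emb]
@[simp] lemma emb_1 (y : E2) (z : ℝ) : emb y z 1 = y 1 := by simp [emb]
@[simp] lemma emb_2 (y : E2) (z : ℝ) : emb y z 2 = z := by simp [emb]

lemma emb_norm (y : E2) (z : ℝ) : ‖emb y z‖ = rr z y := by
  unfold rr
  rw [EuclideanSpace.norm_eq, EuclideanSpace.norm_sq_eq]
  simp [Fin.sum_univ_three, Fin.sum_univ_two]

lemma emb_cont : Continuous (fun w : E2 × ℝ => emb w.1 w.2) := by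
  unfold emb
  refine (ContinuousLinearEquiv.continuous _).comp ?_
  refine continuous_pi fun i => ?_
  fin_cases i <;> simp <;> fun_prop

noncomputable def pr (x : E3) : E2 := !₂[x 0, x 1]
@[simp] lemma pr_0 (x : E3) : pr x 0 = x 0 := by simp [pr]
@[simp] lemma pr_1 (x : E3) : pr x 1 = x 1 := by simp [pr]
lemma pr_cont : Continuous pr := by
  unfold pr
  refine (PiLp.continuous_toLp 2 _).comp ?_
  refine continuous_pi fun i => ?_
  fin_cases i <;> simp <;> fun_prop
@[simp] lemma pr_emb (y : E2) (z : ℝ) : pr (emb y z) = y := by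
  ext i; fin_cases i <;> simp

lemma emb_add (y : E2) (x : E3) : emb y 0 + x = emb (y + pr x) (x 2) := by
  ext i; fin_cases i <;> simp

lemma polar (f : E3 → ℂ) (hf : Integrable f) :
    IntegrableOn (fun t : ℝ => ((t^2 : ℝ) : ℂ) *
      ∫ η : Metric.sphere (0 : E3) 1, f (t • (η : E3)) ∂((volume : Measure E3).toSphere))
      (Set.Ioi 0) ∧
    ∫ x, f x = ∫ t in Set.Ioi (0:ℝ), ((t^2 : ℝ) : ℂ) *
      ∫ η : Metric.sphere (0 : E3) 1, f (t • (η : E3)) ∂((volume : Measure E3).toSphere) := by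
  have hmp := (volume : Measure E3).measurePreserving_homeomorphUnitSphereProd
  have hdim : Module.finrank ℝ E3 - 1 = 2 := by simp
  rw [hdim] at hmp
  let F : Metric.sphere (0 : E3) 1 × Set.Ioi (0:ℝ) → ℂ := fun x => f ((x.2 : ℝ) • (x.1 : E3))
  have hF : ∀ x : ({(0:E3)}ᶜ : Set E3), F (homeomorphUnitSphereProd E3 x) = f x := by
    intro x
    have hx : ‖(x : E3)‖ ≠ 0 := norm_ne_zero_iff.2 x.2
    simp [F, smul_smul, hx]
  have hfi : Integrable (fun x : ({(0:E3)}ᶜ : Set E3) => f x)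
      ((volume : Measure E3).comap (↑)) := by
    have : IntegrableOn f ({(0:E3)}ᶜ) := hf.integrableOn
    rwa [integrableOn_iff_comap_subtypeVal (by measurability)] at this
  have hFi : Integrable F ((volume : Measure E3).toSphere.prod (Measure.volumeIoiPow 2)) := by
    rw [← hmp.integrable_comp_emb (Homeomorph.measurableEmbedding _)]
    simpa only [Function.comp_def, hF] using hfi
  have hFub : ∫ x, f x = ∫ x, F x ∂((volume : Measure E3).toSphere.prod (Measure.volumeIoiPow 2)) := by
    rw [← hmp.integral_comp (Homeomorph.measurableEmbedding _)]
    simp only [hF]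
    rw [integral_subtype_comap (measurableSet_singleton _).compl fun x ↦ f x,
        restrict_compl_singleton]
  let H : ℝ → ℂ := fun t => ∫ η : Metric.sphere (0 : E3) 1, f (t • (η : E3)) ∂((volume : Measure E3).toSphere)
  have h1 : Integrable (fun t : Set.Ioi (0:ℝ) => H t) (Measure.volumeIoiPow 2) :=
    hFi.integral_prod_right
  have h2 : ∫ x, f x = ∫ t : Set.Ioi (0:ℝ), H t ∂(Measure.volumeIoiPow 2) := by
    rw [hFub]; exact integral_prod_symm _ hFi
  constructor
  · rw [Measure.volumeIoiPow, integrable_withDensity_iff_integrable_smul' (by fun_prop) (by simp)] at h1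
    rw [integrableOn_iff_comap_subtypeVal measurableSet_Ioi]
    refine h1.congr (ae_of_all _ ?_)
    rintro ⟨x, hx : 0 < x⟩
    simp (disch := positivity) only [ENNReal.toReal_ofReal]
    simp [H]
  · rw [h2]
    simp only [Measure.volumeIoiPow, ENNReal.ofReal]
    rw [integral_withDensity_eq_integral_smul,
        integral_subtype_comap measurableSet_Ioi fun a ↦ Real.toNNReal (a ^ 2) • H a,
        setIntegral_congr_fun measurableSet_Ioi fun x hx ↦ ?_]
    · rw [NNReal.smul_def, Real.coe_toNNReal _ (pow_nonneg hx.out.le _)]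
      simp [H]
    · exact (measurable_subtype_coe.pow_const _).real_toNNReal

lemma schw_bound (h : SchwartzMap E3 ℂ) : ∃ C : ℝ, ∀ y z, ‖h (emb y z)‖ ≤ C * (1 + ‖y‖) ^ (-3 : ℝ) := by
  refine ⟨2 ^ 3 * (Finset.Iic ((3, 0) : ℕ × ℕ)).sup
    (fun m => SchwartzMap.seminorm ℝ m.1 m.2) h, fun y z => ?_⟩
  · have := SchwartzMap.one_add_le_sup_seminorm_apply (𝕜 := ℝ) (m := (3, 0)) (k := 3) (n := 0)
      le_rfl le_rfl h (emb y z)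
    rw [norm_iteratedFDeriv_zero] at this
    have h2 : (1 + ‖y‖)^3 * ‖h (emb y z)‖ ≤ (1 + ‖emb y z‖)^3 * ‖h (emb y z)‖ := by
      gcongr
      rw [emb_norm]; exact rr_ge z y
    rw [Real.rpow_neg (by positivity), ← div_eq_mul_inv, le_div_iff₀ (by positivity), mul_comm]
    refine le_trans ?_ (h2.trans this)
    norm_cast

lemma int_jap : Integrable (fun y : E2 => (1 + ‖y‖) ^ (-3 : ℝ)) :=
  integrable_one_add_norm (by simp; norm_num)

noncomputable def gg (h : SchwartzMap E3 ℂ) (σ : E2) (z : ℝ) : ℂ :=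
  ∫ y : E2, h (emb y z) * cexp (I * ((⟪σ, y⟫ : ℝ) : ℂ))

lemma gg_cont (h : SchwartzMap E3 ℂ) (σ : E2) : Continuous (gg h σ) := by
  obtain ⟨C, hC⟩ := schw_bound h
  have hc := h.continuous.comp emb_cont
  refine continuous_of_dominated (bound := fun y => C * (1 + ‖y‖) ^ (-3 : ℝ)) (fun z => ?_)
    (fun z => ae_of_all _ fun y => ?_) (int_jap.const_mul C) (ae_of_all _ fun y => ?_)
  · have : Continuous (fun y => h (emb y z)) := hc.comp (by fun_prop : Continuous fun y => (y, z))
    exact (this.mul (by fun_prop)).aestronglyMeasurable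
  · rw [norm_mul, norm_ph', mul_one]; exact hC y z
  · have : Continuous (fun z => h (emb y z)) := hc.comp (by fun_prop : Continuous fun z => (y, z))
    exact this.mul (by fun_prop)

lemma gg_bound (h : SchwartzMap E3 ℂ) (σ : E2) : ∃ C : ℝ, ∀ z, ‖gg h σ z‖ ≤ C := by
  obtain ⟨C, hC⟩ := schw_bound h
  refine ⟨∫ y : E2, C * (1 + ‖y‖) ^ (-3 : ℝ), fun z => ?_⟩
  refine norm_integral_le_of_norm_le (int_jap.const_mul C) (ae_of_all _ fun y => ?_)
  rw [norm_mul, norm_ph', mul_one]; exact hC y z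

lemma gg_neg (h : SchwartzMap E3 ℂ) (hcausal : ∀ x : E3, x 2 < 0 → h x = 0) (σ : E2) (z : ℝ)
    (hz : z < 0) : gg h σ z = 0 := by
  unfold gg
  have : ∀ y, h (emb y z) = 0 := fun y => hcausal _ (by simpa using hz)
  simp [this]

lemma inner2 (σ y : E2) : (⟪σ, y⟫ : ℝ) = σ 0 * y 0 + σ 1 * y 1 := by
  rw [PiLp.inner_apply]; simp [Fin.sum_univ_two]; ring

lemma ph_int (h : SchwartzMap E3 ℂ) (σ : E2) (ϱ : ℝ) : Integrable (fun x : E3 =>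
    h x * Complex.exp (Complex.I * ((σ 0 * x 0 + σ 1 * x 1 + ϱ * x 2 : ℝ) : ℂ))) := by
  refine h.integrable.norm.mono' ?_ (ae_of_all _ fun x => ?_)
  · have := h.continuous
    exact Continuous.aestronglyMeasurable (by fun_prop)
  · rw [norm_mul, norm_ph', mul_one]

lemma gg_int (h : SchwartzMap E3 ℂ) (σ : E2) : Integrable (gg h σ) := by
  have := (emb_int _ (ph_int h σ 0)).integral_prod_right
  refine this.congr (ae_of_all _ fun z => ?_)
  simp [gg, inner2]

lemma gg_ft (h : SchwartzMap E3 ℂ) (σ : E2) (ϱ : ℝ) :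
    ∫ x : E3, h x * Complex.exp (Complex.I * ((σ 0 * x 0 + σ 1 * x 1 + ϱ * x 2 : ℝ) : ℂ)) =
    ∫ z : ℝ, gg h σ z * cexp (I * ((ϱ * z : ℝ) : ℂ)) := by
  rw [emb_integral _ (ph_int h σ ϱ)]
  refine integral_congr_ae (ae_of_all _ fun z => ?_)
  simp only [gg]
  rw [← integral_mul_const]
  refine integral_congr_ae (ae_of_all _ fun y => ?_)
  simp only [emb_0, emb_1, emb_2, inner2]
  rw [mul_assoc, ← Complex.exp_add]
  congr 2
  push_cast; ring

lemma Q_joint (h : SchwartzMap E3 ℂ) (σ : E2) (t : ℝ) :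
    Integrable (fun w : E2 × Metric.sphere (0 : E3) 1 =>
      h (emb w.1 0 + t • (w.2 : E3)) * cexp (I * ((⟪σ, w.1⟫ : ℝ) : ℂ)))
      (volume.prod (volume : Measure E3).toSphere) := by
  obtain ⟨C, hC⟩ := schw_bound h
  have hcont : Continuous (fun w : E2 × Metric.sphere (0 : E3) 1 =>
      h (emb w.1 0 + t • (w.2 : E3)) * cexp (I * ((⟪σ, w.1⟫ : ℝ) : ℂ))) := by
    have h1 := h.continuous
    have h2 : Continuous (fun y : E2 => emb y 0) :=
      emb_cont.comp (by fun_prop : Continuous fun y : E2 => (y, (0:ℝ)))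
    fun_prop
  have hbd : ∀ y (η : Metric.sphere (0 : E3) 1),
      ‖h (emb y 0 + t • (η : E3)) * cexp (I * ((⟪σ, y⟫ : ℝ) : ℂ))‖ ≤
      C * (1 + ‖y + pr (t • (η:E3))‖) ^ (-3 : ℝ) := by
    intro y η
    rw [norm_mul, norm_ph', mul_one, emb_add]
    exact hC _ _
  have hsl : ∀ η : Metric.sphere (0 : E3) 1, Integrable (fun y =>
      C * (1 + ‖y + pr (t • (η:E3))‖) ^ (-3 : ℝ)) := fun η =>
    (int_jap.const_mul C).comp_add_right (pr (t • (η:E3)))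
  rw [integrable_prod_iff' hcont.aestronglyMeasurable]
  refine ⟨ae_of_all _ fun η => ?_, ?_⟩
  · refine (hsl η).mono' ?_ (ae_of_all _ fun y => hbd y η)
    exact (hcont.comp (by fun_prop : Continuous fun y => (y, η))).aestronglyMeasurable
  · refine (integrable_const (∫ y : E2, C * (1 + ‖y‖) ^ (-3 : ℝ))).mono' ?_ (ae_of_all _ fun η => ?_)
    · exact hcont.norm.aestronglyMeasurable.prod_swap.integral_prod_right'
    · rw [Real.norm_of_nonneg (integral_nonneg fun _ => norm_nonneg _)]
      rw [← integral_add_right_eq_self (fun y : E2 => C * (1 + ‖y‖) ^ (-3 : ℝ)) (pr (t • (η:E3)))]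
      refine integral_mono_of_nonneg (ae_of_all _ fun _ => norm_nonneg _) (hsl η)
        (ae_of_all _ fun y => hbd y η)

lemma Q_eq (h : SchwartzMap E3 ℂ) (σ : E2) (t : ℝ) (ξ : E2) :
    Q h t ξ * cexp (I * ((⟪σ, ξ⟫ : ℝ) : ℂ)) = ((t / (4 * π) : ℝ) : ℂ) *
    ∫ η : Metric.sphere (0 : E3) 1, h (emb ξ 0 + t • (η : E3)) * cexp (I * ((⟪σ, ξ⟫ : ℝ) : ℂ))
    ∂((volume : Measure E3).toSphere) := by
  unfold Q
  rw [integral_mul_const, mul_assoc]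

lemma Q_int (h : SchwartzMap E3 ℂ) (σ : E2) (t : ℝ) :
    Integrable (fun ξ => Q h t ξ * cexp (I * ((⟪σ, ξ⟫ : ℝ) : ℂ))) := by
  simp only [Q_eq]
  exact (Q_joint h σ t).integral_prod_left.const_mul _

lemma Q_ft (h : SchwartzMap E3 ℂ) (σ : E2) (t : ℝ) :
    ∫ ξ, Q h t ξ * cexp (I * ((⟪σ, ξ⟫ : ℝ) : ℂ)) = ((t / (4 * π) : ℝ) : ℂ) *
    ∫ η : Metric.sphere (0 : E3) 1, cexp (-I * ((⟪σ, pr (t • (η : E3))⟫ : ℝ) : ℂ)) *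
      gg h σ ((t • (η : E3)) 2) ∂((volume : Measure E3).toSphere) := by
  simp only [Q_eq]
  rw [integral_const_mul, integral_integral_swap (Q_joint h σ t)]
  congr 1
  refine integral_congr_ae (ae_of_all _ fun η => ?_)
  simp only [gg]
  rw [← integral_const_mul, ← integral_add_right_eq_self
    (fun y => cexp (-I * ((⟪σ, pr (t • (η : E3))⟫ : ℝ) : ℂ)) *
      (h (emb y ((t • (η : E3)) 2)) * cexp (I * ((⟪σ, y⟫ : ℝ) : ℂ)))) (pr (t • (η : E3)))]
  refine integral_congr_ae (ae_of_all _ fun y => ?_)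
  simp only [emb_add]
  rw [mul_left_comm, ← Complex.exp_add, inner_add_right]
  congr 2
  push_cast; ring

noncomputable def ff (h : SchwartzMap E3 ℂ) (σ : E2) (p : ℂ) (x : E3) : ℂ :=
  cexp (-(p * ‖x‖)) / (4 * π * ‖x‖) * (cexp (-I * ((⟪σ, pr x⟫ : ℝ) : ℂ)) * gg h σ (x 2))

lemma ff_int (h : SchwartzMap E3 ℂ) (σ : E2) (p : ℂ) (hp : 0 < p.re) : Integrable (ff h σ p) := by
  obtain ⟨C, hC⟩ := gg_bound h σ
  refine ((int_exp_norm3 p.re hp).const_mul ((4 * π)⁻¹ * C)).mono' ?_ (ae_of_all _ fun x => ?_)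
  · have h1 := (gg_cont h σ).measurable
    have h2 := pr_cont.measurable
    refine Measurable.aestronglyMeasurable ?_
    unfold ff
    fun_prop
  · unfold ff
    rw [norm_mul, norm_mul, norm_ph, norm_div, Complex.norm_exp]
    have : ‖(4 * π * ‖x‖ : ℂ)‖ = 4 * π * ‖x‖ := by
      simp [abs_of_pos Real.pi_pos]
    rw [this]
    simp only [Complex.neg_re, Complex.re_mul_ofReal, one_mul]
    calc Real.exp (-(p.re * ‖x‖)) / (4 * π * ‖x‖) * ‖gg h σ (x 2)‖
        ≤ Real.exp (-(p.re * ‖x‖)) / (4 * π * ‖x‖) * C := by gcongr; exact hC _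
      _ = _ := by field_simp

lemma ff_polar (h : SchwartzMap E3 ℂ) (σ : E2) (p : ℂ) (t : ℝ) (ht : 0 < t) :
    ((t^2 : ℝ) : ℂ) * ∫ η : Metric.sphere (0 : E3) 1, ff h σ p (t • (η : E3))
      ∂((volume : Measure E3).toSphere) =
    cexp (-(p * t)) * ∫ ξ, Q h t ξ * cexp (I * ((⟪σ, ξ⟫ : ℝ) : ℂ)) := by
  rw [Q_ft]
  have hn : ∀ η : Metric.sphere (0 : E3) 1, ‖t • (η : E3)‖ = t := by
    intro η
    rw [norm_smul, norm_eq_of_mem_sphere, Real.norm_of_nonneg ht.le, mul_one]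
  unfold ff
  simp only [hn]
  rw [integral_const_mul]
  have htc : (t : ℂ) ≠ 0 := by exact_mod_cast ht.ne'
  have hpi : (π : ℂ) ≠ 0 := by exact_mod_cast Real.pi_ne_zero
  push_cast
  field_simp

lemma ff_cart (h : SchwartzMap E3 ℂ) (hcausal : ∀ x : E3, x 2 < 0 → h x = 0)
    (σ : E2) (p : ℂ) (hp : 0 < p.re) :
    ∫ x, ff h σ p x = ∫ z : ℝ, gg h σ z * (cexp (-(kk σ p * z)) / (2 * kk σ p)) := by
  rw [emb_integral _ (ff_int h σ p hp)]
  refine integral_congr_ae ?_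
  have hne : ∀ᵐ z : ℝ, z ≠ 0 := by simp [ae_iff]
  filter_upwards [hne] with z hz
  rcases lt_or_gt_of_ne hz with hz | hz
  · simp [ff, gg_neg h hcausal σ z hz]
  · have : ∀ y, ff h σ p (emb y z) = gg h σ z * (4 * (π : ℂ))⁻¹ * Ker σ z p y := by
      intro y
      unfold ff Ker
      have h0 : ((rr z y : ℝ) : ℂ) ≠ 0 := by exact_mod_cast (rr_pos z hz y).ne'
      rw [emb_norm, pr_emb, emb_2]
      field_simp
    simp only [this]
    rw [integral_const_mul, yuk σ z hz p hp]
    have hpi : (π : ℂ) ≠ 0 := by exact_mod_cast Real.pi_ne_zero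
    have := kk_ne σ p hp
    field_simp
    norm_num

lemma kk_lim (σ : E2) (ϱ ω : ℝ) (hϱ : ϱ ≠ 0) (hω2 : ω^2 = ϱ^2 + ‖σ‖^2) (hωϱ : 0 ≤ ω * ϱ) :
    Tendsto (fun ε : ℝ => kk σ ((ε : ℂ) - I * ω)) (nhdsWithin 0 (Set.Ioi 0)) (nhds (-I * ϱ)) := by
  rw [tendsto_iff_norm_sub_tendsto_zero]
  have hlim : Tendsto (fun ε : ℝ => ‖(ε:ℂ)^2 - 2 * I * ε * ω‖ / |ϱ|) (nhdsWithin 0 (Set.Ioi 0))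
      (nhds 0) := by
    have hc : Continuous (fun ε : ℝ => ‖(ε:ℂ)^2 - 2 * I * ε * ω‖ / |ϱ|) := by fun_prop
    have := hc.tendsto 0
    simp only [Complex.ofReal_zero] at this
    simp at this
    exact this.mono_left nhdsWithin_le_nhds
  refine squeeze_zero' (Eventually.of_forall fun _ => norm_nonneg _) ?_ hlim
  filter_upwards [self_mem_nhdsWithin] with ε hε
  have hε : 0 < ε := hε
  set p : ℂ := (ε : ℂ) - I * ω with hpdef
  have hp : 0 < p.re := by simpa [hpdef] using hε
  have hk := kk_re σ p hp
  have hsq := kk_sq σ p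
  set k := kk σ p
  have hωc : (ω:ℂ)^2 = (ϱ:ℂ)^2 + (‖σ‖:ℂ)^2 := by exact_mod_cast hω2
  have hk2 : k^2 + ϱ^2 = (ε:ℂ)^2 - 2 * I * ε * ω := by
    rw [hsq, hpdef]
    linear_combination (ω:ℂ)^2 * I_sq - hωc
  have hfac : (k - -I * ϱ) * (k - I * ϱ) = (ε:ℂ)^2 - 2 * I * ε * ω := by
    rw [← hk2]; linear_combination (-(ϱ:ℂ)^2) * I_sq
  have him : 2 * k.re * k.im = -2 * ε * ω := by
    have := congrArg Complex.im hsq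
    simp [pow_two, hpdef] at this
    linarith
  have hkim : k.im * ϱ ≤ 0 := by
    by_contra hcon
    push Not at hcon
    have h1 : 0 < k.re * (k.im * ϱ) := mul_pos hk hcon
    have h2 : k.re * (k.im * ϱ) = - (ε * (ω * ϱ)) := by linear_combination (ϱ/2) * him
    have h3 : 0 ≤ ε * (ω * ϱ) := mul_nonneg hε.le hωϱ
    linarith
  have hge : |ϱ| ≤ ‖k - I * ϱ‖ := by
    have h1 : |(k - I * ϱ).im| ≤ ‖k - I * ϱ‖ := Complex.abs_im_le_norm _
    refine le_trans ?_ h1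
    simp
    refine sq_le_sq.1 ?_
    nlinarith [sq_nonneg k.im]
  rw [le_div_iff₀ (abs_pos.2 hϱ), ← hfac, norm_mul]
  gcongr

lemma gg_lim (h : SchwartzMap E3 ℂ) (hcausal : ∀ x : E3, x 2 < 0 → h x = 0)
    (σ : E2) (ϱ ω : ℝ) (hϱ : ϱ ≠ 0) (hω2 : ω^2 = ϱ^2 + ‖σ‖^2) (hωϱ : 0 ≤ ω * ϱ) :
    Tendsto (fun ε : ℝ => ∫ z : ℝ, gg h σ z * cexp (-(kk σ ((ε : ℂ) - I * ω) * z)))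
      (nhdsWithin 0 (Set.Ioi 0)) (nhds (∫ z : ℝ, gg h σ z * cexp (-(-I * ϱ * z)))) := by
  refine tendsto_integral_filter_of_dominated_convergence (fun z => ‖gg h σ z‖) ?_ ?_
    (gg_int h σ).norm ?_
  · refine Eventually.of_forall fun ε => ?_
    have := gg_cont h σ
    exact Continuous.aestronglyMeasurable (by fun_prop)
  · filter_upwards [self_mem_nhdsWithin] with ε hε
    refine ae_of_all _ fun z => ?_
    rcases lt_or_ge z 0 with hz | hz
    · simp [gg_neg h hcausal σ z hz]
    · have hk := kk_re σ ((ε : ℂ) - I * ω) (by simpa using hε)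
      rw [norm_mul, Complex.norm_exp]
      refine mul_le_of_le_one_right (norm_nonneg _) ?_
      rw [Real.exp_le_one_iff, Complex.neg_re, Complex.re_mul_ofReal]
      have := mul_nonneg hk.le hz
      linarith
  · refine ae_of_all _ fun z => ?_
    refine Tendsto.const_mul _ ?_
    refine (Complex.continuous_exp.tendsto _).comp ?_
    exact ((kk_lim σ ϱ ω hϱ hω2 hωϱ).mul_const _).neg

theorem stmt0 (h : SchwartzMap (EuclideanSpace ℝ (Fin 3)) ℂ)
    (hcausal : ∀ x : EuclideanSpace ℝ (Fin 3), x 2 < 0 → h x = 0)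
    (σ : EuclideanSpace ℝ (Fin 2)) (ϱ : ℝ) (hϱ : ϱ ≠ 0) :
    (∀ t : ℝ, Integrable (fun ξ : EuclideanSpace ℝ (Fin 2) =>
        Q h t ξ * Complex.exp (Complex.I * ((⟪σ, ξ⟫ : ℝ) : ℂ)))) ∧
    (∀ ε : ℝ, 0 < ε → IntegrableOn (fun t : ℝ =>
        Complex.exp ((Complex.I *
            ((Real.sign ϱ * Real.sqrt (ϱ ^ 2 + ‖σ‖ ^ 2) : ℝ) : ℂ) - (ε : ℂ)) * (t : ℂ)) *
          ∫ ξ : EuclideanSpace ℝ (Fin 2),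
            Q h t ξ * Complex.exp (Complex.I * ((⟪σ, ξ⟫ : ℝ) : ℂ))) (Set.Ioi (0 : ℝ))) ∧
    ∃ L : ℂ,
      Tendsto (fun ε : ℝ =>
          (((2 * π : ℝ) ^ (-(3 : ℝ) / 2) : ℝ) : ℂ) * ∫ t in Set.Ioi (0 : ℝ),
            Complex.exp ((Complex.I *
                ((Real.sign ϱ * Real.sqrt (ϱ ^ 2 + ‖σ‖ ^ 2) : ℝ) : ℂ) - (ε : ℂ)) * (t : ℂ)) *
              ∫ ξ : EuclideanSpace ℝ (Fin 2),
                Q h t ξ * Complex.exp (Complex.I * ((⟪σ, ξ⟫ : ℝ) : ℂ)))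
        (nhdsWithin 0 (Set.Ioi 0)) (nhds L) ∧
      (((2 * π : ℝ) ^ (-(3 : ℝ) / 2) : ℝ) : ℂ) *
          (∫ x : EuclideanSpace ℝ (Fin 3),
            h x * Complex.exp (Complex.I * ((σ 0 * x 0 + σ 1 * x 1 + ϱ * x 2 : ℝ) : ℂ)))
        = -2 * Complex.I * (ϱ : ℂ) * L := by
  have hpos : 0 ≤ ϱ ^ 2 + ‖σ‖ ^ 2 := by positivity
  have hsg : Real.sign ϱ ^ 2 = 1 := by
    rcases Real.sign_apply_eq_of_ne_zero ϱ hϱ with h1 | h1 <;> rw [h1] <;> norm_num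
  have hω2 : (Real.sign ϱ * Real.sqrt (ϱ ^ 2 + ‖σ‖ ^ 2)) ^ 2 = ϱ ^ 2 + ‖σ‖ ^ 2 := by
    rw [mul_pow, hsg, Real.sq_sqrt hpos, one_mul]
  have hωϱ : 0 ≤ (Real.sign ϱ * Real.sqrt (ϱ ^ 2 + ‖σ‖ ^ 2)) * ϱ := by
    have h1 : 0 ≤ Real.sign ϱ * ϱ := by
      rcases lt_or_gt_of_ne hϱ with h1 | h1
      · rw [Real.sign_of_neg h1]; linarith
      · rw [Real.sign_of_pos h1]; linarith
    have := mul_nonneg h1 (Real.sqrt_nonneg (ϱ ^ 2 + ‖σ‖ ^ 2))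
    linarith
  generalize Real.sign ϱ * Real.sqrt (ϱ ^ 2 + ‖σ‖ ^ 2) = ω at hω2 hωϱ ⊢
  have hp : ∀ ε : ℝ, 0 < ε → 0 < ((ε : ℂ) - I * ω).re := fun ε hε => by simpa using hε
  have hrw : ∀ ε : ℝ, Set.EqOn (fun t : ℝ => ((t^2 : ℝ) : ℂ) *
      ∫ η : Metric.sphere (0 : E3) 1, ff h σ ((ε : ℂ) - I * ω) (t • (η : E3))
      ∂((volume : Measure E3).toSphere))
      (fun t : ℝ => Complex.exp ((Complex.I * (ω : ℂ) - (ε : ℂ)) * (t : ℂ)) *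
          ∫ ξ : EuclideanSpace ℝ (Fin 2),
            Q h t ξ * Complex.exp (Complex.I * ((⟪σ, ξ⟫ : ℝ) : ℂ))) (Set.Ioi 0) := by
    intro ε t ht
    simp only
    rw [ff_polar h σ _ t ht]
    congr 2
    ring
  refine ⟨fun t => Q_int h σ t, fun ε hε => ?_, ?_⟩
  · exact (polar _ (ff_int h σ _ (hp ε hε))).1.congr_fun (hrw ε) measurableSet_Ioi
  · have hϱc : (ϱ : ℂ) ≠ 0 := by exact_mod_cast hϱ
    refine ⟨(((2 * π : ℝ) ^ (-(3 : ℝ) / 2) : ℝ) : ℂ) *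
      ((∫ z : ℝ, gg h σ z * cexp (-(-I * ϱ * z))) / (2 * (-I * ϱ))), ?_, ?_⟩
    · refine Tendsto.const_mul _ ?_
      refine Tendsto.congr' ?_ ((gg_lim h hcausal σ ϱ ω hϱ hω2 hωϱ).div
        ((kk_lim σ ϱ ω hϱ hω2 hωϱ).const_mul 2) ?_)
      · filter_upwards [self_mem_nhdsWithin] with ε hε
        have hε : 0 < ε := hε
        rw [← setIntegral_congr_fun measurableSet_Ioi (hrw ε),
          ← (polar _ (ff_int h σ _ (hp ε hε))).2, ff_cart h hcausal σ _ (hp ε hε),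
          Pi.div_apply, ← integral_div]
        simp only [mul_div_assoc]
      · simp [hϱc]
    · rw [gg_ft h σ ϱ]
      have : ∀ z : ℝ, I * ((ϱ * z : ℝ) : ℂ) = -(-I * ϱ * z) := by
        intro z; push_cast; ring
      simp only [this]
      have hI := I_ne_zero
      field_simp
end

section
/- Let h : ℝ²×ℝ → ℂ be a Schwartz function with h(x₁₂,x₃) = 0 whenever x₃ < 0. If the planar photoacoustic data vanishes identically, i.e. (t/(4π)) ∫_{S²} h((ξ,0)+tη) dS(η) = 0 for every t > 0 and every ξ ∈ ℝ², then h = 0. -/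
open MeasureTheory Real Complex

open scoped BoundedContinuousFunction

/-- If all spherical integrals about the origin vanish then the integral vanishes. -/
lemma polar_zero (F : (EuclideanSpace ℝ (Fin 3)) → ℂ)
    (hF : ∀ r : ℝ, 0 < r → ∫ η : Metric.sphere (0 : (EuclideanSpace ℝ (Fin 3))) 1, F (r • (η : (EuclideanSpace ℝ (Fin 3))))
      ∂((volume : Measure (EuclideanSpace ℝ (Fin 3))).toSphere) = 0) : ∫ x, F x = 0 := by
  have h1 : ∫ x, F x = ∫ x : ({(0)}ᶜ : Set (EuclideanSpace ℝ (Fin 3))), F x.1 ∂((volume : Measure (EuclideanSpace ℝ (Fin 3))).comap (↑)) := by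
    rw [integral_subtype_comap (measurableSet_singleton _).compl F,
      restrict_compl_singleton]
  have h2 := (volume : Measure (EuclideanSpace ℝ (Fin 3))).measurePreserving_homeomorphUnitSphereProd.integral_comp
        (Homeomorph.measurableEmbedding _)
        (fun p : Metric.sphere (0 : (EuclideanSpace ℝ (Fin 3))) 1 × Set.Ioi (0 : ℝ) => F ((p.2 : ℝ) • (p.1 : (EuclideanSpace ℝ (Fin 3)))))
  have h3 : ∀ x : ({(0)}ᶜ : Set (EuclideanSpace ℝ (Fin 3))), F (((homeomorphUnitSphereProd (EuclideanSpace ℝ (Fin 3)) x).2 : ℝ) •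
      ((homeomorphUnitSphereProd (EuclideanSpace ℝ (Fin 3)) x).1 : (EuclideanSpace ℝ (Fin 3)))) = F x.1 := by
    intro x
    have hx : ‖x.1‖ ≠ 0 := norm_ne_zero_iff.2 x.2
    congr 1
    simp [smul_smul, hx]
  simp only [h3] at h2
  rw [h1, h2]
  by_cases hi : Integrable
    (fun p : Metric.sphere (0 : (EuclideanSpace ℝ (Fin 3))) 1 × Set.Ioi (0 : ℝ) => F ((p.2 : ℝ) • (p.1 : (EuclideanSpace ℝ (Fin 3)))))
    ((volume : Measure (EuclideanSpace ℝ (Fin 3))).toSphere.prod (Measure.volumeIoiPow (Module.finrank ℝ (EuclideanSpace ℝ (Fin 3)) - 1)))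
  · rw [integral_prod_symm _ hi]
    have : ∀ y : Set.Ioi (0 : ℝ), ∫ x : Metric.sphere (0 : (EuclideanSpace ℝ (Fin 3))) 1, F ((y : ℝ) • (x : (EuclideanSpace ℝ (Fin 3))))
      ∂((volume : Measure (EuclideanSpace ℝ (Fin 3))).toSphere) = 0 := fun y => hF y y.2
    simp only [this, integral_zero]
  · exact integral_undef hi

/-- The test functions. -/
noncomputable def W (s a b : ℝ) (x : (EuclideanSpace ℝ (Fin 3))) : ℝ := Real.exp (-s * ‖x‖ ^ 2 + a * x 0 + b * x 1)

lemma W_cont (s a b : ℝ) : Continuous (W s a b) := by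
  unfold W; fun_prop

lemma W_pos (s a b : ℝ) (x : (EuclideanSpace ℝ (Fin 3))) : 0 < W s a b x := Real.exp_pos _

lemma W_mul (s a b s' a' b' : ℝ) (x : (EuclideanSpace ℝ (Fin 3))) :
    W s a b x * W s' a' b' x = W (s + s') (a + a') (b + b') x := by
  unfold W; rw [← Real.exp_add]; congr 1; ring

lemma W_bdd {s : ℝ} (hs : 0 < s) (a b : ℝ) : ∃ C, ∀ x, W s a b x ≤ C := by
  refine ⟨Real.exp ((a ^ 2 + b ^ 2) / (4 * s)), fun x => Real.exp_le_exp.2 ?_⟩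
  rw [EuclideanSpace.norm_sq_eq, Fin.sum_univ_three]
  simp only [Real.norm_eq_abs, sq_abs]
  rw [le_div_iff₀ (by positivity)]
  nlinarith [sq_nonneg (2 * s * x 0 - a), sq_nonneg (2 * s * x 1 - b), sq_nonneg (s * x 2)]

lemma exists_bcf {X : Set (EuclideanSpace ℝ (Fin 3))} {s : ℝ} (hs : 0 < s) (a b : ℝ) :
    ∃ g : X →ᵇ ℝ, ∀ x, g x = W s a b x := by
  obtain ⟨C, hC⟩ := W_bdd hs a b
  refine ⟨BoundedContinuousFunction.ofNormedAddCommGroup (fun x : X => W s a b x)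
    ((W_cont s a b).comp continuous_subtype_val) C ?_, fun x => rfl⟩
  intro x
  rw [Real.norm_of_nonneg (W_pos _ _ _ _).le]
  exact hC x

lemma real_case (f : (EuclideanSpace ℝ (Fin 3)) → ℝ) (hc : Continuous f) (hi : Integrable f)
    (hcausal : ∀ x : (EuclideanSpace ℝ (Fin 3)), x 2 < 0 → f x = 0)
    (h0 : ∀ s a b : ℝ, 0 < s → ∫ x, f x * W s a b x = 0) : ∀ x, f x = 0 := by
  set X : Set (EuclideanSpace ℝ (Fin 3)) := {x | 0 ≤ x 2} with hX
  have hXc : IsClosed X := isClosed_le continuous_const (by fun_prop)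
  have hXm : MeasurableSet X := hXc.measurableSet
  have : CompleteSpace X := hXc.completeSpace_coe
  set ν : Measure X := (volume : Measure (EuclideanSpace ℝ (Fin 3))).comap Subtype.val with hν
  -- integrability of products
  have hWint : ∀ s a b : ℝ, 0 < s → Integrable (fun x => f x * W s a b x) := by
    intro s a b hs
    obtain ⟨C, hC⟩ := W_bdd hs a b
    refine hi.mul_bdd (c := C) (W_cont s a b).aestronglyMeasurable (.of_forall fun x => ?_)
    rw [Real.norm_of_nonneg (W_pos _ _ _ _).le]
    exact hC x
  have hWintX : ∀ s a b : ℝ, 0 < s → Integrable (fun x : X => f x * W s a b x) ν := by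
    intro s a b hs
    exact (integrableOn_iff_comap_subtypeVal hXm).1 (hWint s a b hs).integrableOn
  have h0X : ∀ s a b : ℝ, 0 < s → ∫ x : X, f x * W s a b x ∂ν = 0 := by
    intro s a b hs
    rw [hν, integral_subtype_comap hXm (fun x => f x * W s a b x),
      setIntegral_eq_integral_of_forall_compl_eq_zero, h0 s a b hs]
    intro x hx
    rw [hcausal x (not_le.1 hx), zero_mul]
  set u : X → ℝ := fun x => f x * W 1 0 0 x with hu
  have hum : Measurable u := by
    refine Continuous.measurable ?_
    exact (hc.mul (W_cont 1 0 0)).comp continuous_subtype_val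
  have hui : Integrable u ν := hWintX 1 0 0 one_pos
  set p : X → NNReal := fun x => (u x).toNNReal with hp
  set n : X → NNReal := fun x => (-u x).toNNReal with hn
  have hpm : Measurable p := hum.real_toNNReal
  have hnm : Measurable n := hum.neg.real_toNNReal
  set P := ν.withDensity (fun x => (p x : ENNReal)) with hP
  set N := ν.withDensity (fun x => (n x : ENNReal)) with hN
  have : IsFiniteMeasure P := isFiniteMeasure_withDensity_ofReal hui.2
  have : IsFiniteMeasure N := isFiniteMeasure_withDensity_ofReal hui.neg.2
  let S : Set (X →ᵇ ℝ) := {g | ∃ s a b : ℝ, 0 ≤ s ∧ ∀ x, g x = W s a b x}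
  let A : StarSubalgebra ℝ (X →ᵇ ℝ) :=
    { Algebra.adjoin ℝ S with
      star_mem' := by
        intro g hg
        have : star g = g := by ext x; simp
        rw [this]; exact hg }
  have hsub : S ⊆ A := fun g hg => Algebra.subset_adjoin hg
  have key : P = N := by
    refine ext_of_forall_mem_subalgebra_integral_eq_of_pseudoEMetric_complete_countable
      (𝕜 := ℝ) (A := A) ?_ ?_
    · intro x y hxy
      have hex : ∃ a b : ℝ, W 1 a b x ≠ W 1 a b y := by
        by_contra! hcon
        apply hxy
        have e0 := Real.exp_injective (hcon 0 0)
        have e1 := Real.exp_injective (hcon 1 0)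
        have e2 := Real.exp_injective (hcon 0 1)
        have f0 : x.1 0 = y.1 0 := by linarith
        have f1 : x.1 1 = y.1 1 := by linarith
        rw [EuclideanSpace.norm_sq_eq, EuclideanSpace.norm_sq_eq, Fin.sum_univ_three,
          Fin.sum_univ_three] at e0
        simp only [Real.norm_eq_abs, sq_abs, f0, f1] at e0
        have f2 : x.1 2 = y.1 2 := by
          have hx2 : 0 ≤ x.1 2 := x.2
          have hy2 : 0 ≤ y.1 2 := y.2
          exact (sq_eq_sq₀ hx2 hy2).1 (by linarith)
        ext i
        fin_cases i
        · exact f0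
        · exact f1
        · exact f2
      obtain ⟨a, b, hab⟩ := hex
      obtain ⟨g, hg⟩ := exists_bcf (X := X) one_pos a b
      refine ⟨g, ⟨g.toContinuousMapStarₐ ℝ, ⟨g, hsub ⟨1, a, b, zero_le_one, hg⟩, rfl⟩, rfl⟩, ?_⟩
      rw [hg, hg]; exact hab
    · intro g hg
      have hg' : g ∈ Submodule.span ℝ (Submonoid.closure S : Set (X →ᵇ ℝ)) := by
        rw [← Algebra.adjoin_eq_span]; exact hg
      clear hg
      induction hg' using Submodule.span_induction with
      | zero => simp
      | add g₁ g₂ _ _ h₁ h₂ =>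
        simp only [BoundedContinuousFunction.coe_add, Pi.add_apply]
        rw [integral_add (g₁.integrable _) (g₂.integrable _),
          integral_add (g₁.integrable _) (g₂.integrable _), h₁, h₂]
      | smul c g _ h₁ =>
        simp only [BoundedContinuousFunction.coe_smul]
        rw [integral_smul, integral_smul, h₁]
      | mem g hg =>
        have hgS : g ∈ S := by
          induction hg using Submonoid.closure_induction with
          | mem g hg => exact hg
          | one => exact ⟨0, 0, 0, le_rfl, fun x => by simp [W]⟩
          | mul g g' _ _ h₁ h₂ =>
            obtain ⟨s, a, b, hs, h⟩ := h₁
            obtain ⟨s', a', b', hs', h'⟩ := h₂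
            exact ⟨s + s', a + a', b + b', add_nonneg hs hs', fun x => by
              rw [BoundedContinuousFunction.mul_apply, h, h', W_mul]⟩
        have hgP := g.integrable P
        have hgN := g.integrable N
        rw [hP, integrable_withDensity_iff_integrable_smul hpm] at hgP
        rw [hN, integrable_withDensity_iff_integrable_smul hnm] at hgN
        rw [hP, hN, integral_withDensity_eq_integral_smul hpm,
          integral_withDensity_eq_integral_smul hnm, ← sub_eq_zero, ← integral_sub hgP hgN]
        obtain ⟨s, a, b, hs, h⟩ := hgS
        rw [← h0X (1 + s) (0 + a) (0 + b) (by linarith)]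
        congr 1
        ext x
        rw [← W_mul, h, NNReal.smul_def, NNReal.smul_def, ← sub_smul, hp, hn, ← mul_assoc]
        simp only [Real.coe_toNNReal']
        rw [max_zero_sub_max_neg_zero_eq_self, smul_eq_mul]
  have hfin : ∫⁻ x, (p x : ENNReal) ∂ν ≠ ⊤ := by
    have := measure_ne_top P Set.univ
    rwa [hP, withDensity_apply _ MeasurableSet.univ, setLIntegral_univ] at this
  have hae := (withDensity_eq_iff hpm.coe_nnreal_ennreal.aemeasurable
    hnm.coe_nnreal_ennreal.aemeasurable hfin).1 key
  have hae' : ∀ᵐ x : X ∂ν, f x = 0 := by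
    filter_upwards [hae] with x hx
    have hx' : (u x).toNNReal = (-u x).toNNReal := ENNReal.coe_injective hx
    have hx2 : max (u x) 0 = max (-u x) 0 := by
      simpa only [Real.coe_toNNReal'] using congrArg NNReal.toReal hx'
    have hx3 : u x = 0 := by
      rw [← max_zero_sub_max_neg_zero_eq_self (u x), hx2, sub_self]
    exact (mul_eq_zero.1 hx3).resolve_right (W_pos _ _ _ _).ne'
  have hae2 : ∀ᵐ x ∂(volume : Measure (EuclideanSpace ℝ (Fin 3))), x ∈ X → f x = 0 := by
    rw [← ae_restrict_iff' hXm, ← map_comap_subtype_coe hXm,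
      (MeasurableEmbedding.subtype_coe hXm).ae_map_iff]
    exact hae'
  have hae3 : f =ᵐ[volume] fun _ => (0 : ℝ) := by
    filter_upwards [hae2] with x hx
    by_cases hxX : x ∈ X
    · exact hx hxX
    · exact hcausal x (not_le.1 hxX)
  intro x
  exact congrFun (Continuous.ae_eq_iff_eq volume hc continuous_const |>.1 hae3) x

theorem stmt1 (h : SchwartzMap (EuclideanSpace ℝ (Fin 3)) ℂ)
    (hcausal : ∀ x : EuclideanSpace ℝ (Fin 3), x 2 < 0 → h x = 0)
    (hdata : ∀ t : ℝ, 0 < t → ∀ ξ : EuclideanSpace ℝ (Fin 2), Q h t ξ = 0) :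
    ∀ x : EuclideanSpace ℝ (Fin 3), h x = 0 := by
  have hi : Integrable (h : (EuclideanSpace ℝ (Fin 3)) → ℂ) := h.integrable
  have hWint : ∀ s a b : ℝ, 0 < s → Integrable (fun x => h x * ((W s a b x : ℝ) : ℂ)) := by
    intro s a b hs
    obtain ⟨C, hC⟩ := W_bdd hs a b
    refine hi.mul_bdd (c := C)
      (Complex.continuous_ofReal.comp (W_cont s a b)).aestronglyMeasurable
      (.of_forall fun x => ?_)
    rw [Complex.norm_real, Real.norm_of_nonneg (W_pos _ _ _ _).le]
    exact hC x
  have hzero : ∀ s a b : ℝ, 0 < s → ∫ x, h x * ((W s a b x : ℝ) : ℂ) = 0 := by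
    intro s a b hs
    set ξ : EuclideanSpace ℝ (Fin 2) := !₂[a / (2 * s), b / (2 * s)] with hξ
    have hg : ∫ x : (EuclideanSpace ℝ (Fin 3)), h (emb ξ 0 + x) * ((Real.exp (-s * ‖x‖ ^ 2) : ℝ) : ℂ) = 0 := by
      apply polar_zero
      intro r hr
      have hq := hdata r hr ξ
      unfold Q at hq
      have hne : ((r / (4 * π) : ℝ) : ℂ) ≠ 0 := by
        exact_mod_cast (by positivity : r / (4 * π) ≠ 0)
      have hq' := (mul_eq_zero.1 hq).resolve_left hne
      have : ∀ η : Metric.sphere (0 : (EuclideanSpace ℝ (Fin 3))) 1,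
          h (emb ξ 0 + r • (η : (EuclideanSpace ℝ (Fin 3)))) * ((Real.exp (-s * ‖r • (η : (EuclideanSpace ℝ (Fin 3)))‖ ^ 2) : ℝ) : ℂ)
          = h (emb ξ 0 + r • (η : (EuclideanSpace ℝ (Fin 3)))) * ((Real.exp (-s * r ^ 2) : ℝ) : ℂ) := by
        intro η
        rw [norm_smul, norm_eq_of_mem_sphere, mul_one, Real.norm_eq_abs, sq_abs]
      simp only [this]
      rw [integral_mul_const, hq', zero_mul]
    have hg2 : ∫ x : (EuclideanSpace ℝ (Fin 3)), h x * ((Real.exp (-s * ‖x - emb ξ 0‖ ^ 2) : ℝ) : ℂ) = 0 := by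
      rw [← integral_add_left_eq_self _ (emb ξ 0)]
      simpa using hg
    have hW : ∀ x : (EuclideanSpace ℝ (Fin 3)), h x * ((W s a b x : ℝ) : ℂ)
        = h x * ((Real.exp (-s * ‖x - emb ξ 0‖ ^ 2) : ℝ) : ℂ)
          * ((Real.exp ((a ^ 2 + b ^ 2) / (4 * s)) : ℝ) : ℂ) := by
      intro x
      rw [mul_assoc, ← Complex.ofReal_mul, ← Real.exp_add, W]
      congr 3
      rw [EuclideanSpace.norm_sq_eq, EuclideanSpace.norm_sq_eq, Fin.sum_univ_three,
          Fin.sum_univ_three]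
      simp only [Real.norm_eq_abs, sq_abs, emb, hξ]
      simp
      field_simp
      ring
    simp only [hW]
    rw [integral_mul_const, hg2, zero_mul]
  have hre : ∀ x, (h x).re = 0 := by
    refine real_case (fun x => (h x).re) (Complex.continuous_re.comp h.continuous) hi.re
      (fun x hx => by simp [hcausal x hx]) ?_
    intro s a b hs
    have := integral_re (hWint s a b hs)
    rw [hzero s a b hs] at this
    simpa using this
  have him : ∀ x, (h x).im = 0 := by
    refine real_case (fun x => (h x).im) (Complex.continuous_im.comp h.continuous) hi.im
      (fun x hx => by simp [hcausal x hx]) ?_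
    intro s a b hs
    have := integral_im (hWint s a b hs)
    rw [hzero s a b hs] at this
    simpa using this
  intro x
  exact Complex.ext (hre x) (him x)
end
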